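/- Let c and b be odd integers with 1 ≤ c ≤ 9 and 3 ≤ b ≤ 9, and let u ∈ U_{[c,b]}. Then there exist arbitrarily long finite sequences of consecutive u-attracted numbers for S_{[c,b]}: for every positive integer N there exists a positive integer n such that n, n + 1, …, n + N - 1 are all u-attracted. -/

import Mathlib

/-- The augmented generalized happy function `S_{[c,b]}`: it maps `a` to `c` plus the
sum of the squares of the base-`b` digits of `a`. -/
def S (c b a : ℕ) : ℕ := c + ((Nat.digits b a).map (· ^ 2)).sum


/-- `u ∈ U_{[c,b]}`: `u` is a positive integer that is a periodic point of `S_{[c,b]}`. -/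
def inU (c b u : ℕ) : Prop := 0 < u ∧ ∃ m, 0 < m ∧ (S c b)^[m] u = u

/-- The sum of the squares of the base-`b` digits of `a`. -/
def digitSqSum (b a : ℕ) : ℕ := ((Nat.digits b a).map (· ^ 2)).sum

theorem S_eq (c b a : ℕ) : S c b a = c + digitSqSum b a := rfl

@[simp] theorem digitSqSum_zero (b : ℕ) : digitSqSum b 0 = 0 := by simp [digitSqSum]

theorem digitSqSum_rec {b : ℕ} (hb : 2 ≤ b) (a : ℕ) :
    digitSqSum b a = (a % b) ^ 2 + digitSqSum b (a / b) := by
  rcases Nat.eq_zero_or_pos a with rfl | ha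
  · simp
  · simp [digitSqSum, Nat.digits_def' hb ha]

theorem digitSqSum_of_lt {b d : ℕ} (hb : 2 ≤ b) (hd : d < b) : digitSqSum b d = d ^ 2 := by
  simp [digitSqSum_rec hb d, Nat.mod_eq_of_lt hd, Nat.div_eq_of_lt hd]

theorem digitSqSum_add_pow_mul {b : ℕ} (hb : 2 ≤ b) (r : ℕ) {a : ℕ} (ha : a < b ^ r) (m : ℕ) :
    digitSqSum b (a + b ^ r * m) = digitSqSum b a + digitSqSum b m := by
  induction r generalizing a with
  | zero =>
    obtain rfl : a = 0 := by simpa using ha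
    simp
  | succ r ih =>
    have e : a + b ^ (r + 1) * m = a + b * (b ^ r * m) := by ring
    have hdiv : a / b < b ^ r := Nat.div_lt_of_lt_mul (by rwa [pow_succ'] at ha)
    rw [digitSqSum_rec hb (a + _), digitSqSum_rec hb a, e, Nat.add_mul_mod_self_left,
      Nat.add_mul_div_left _ _ (by omega), ih hdiv, add_assoc]

theorem digitSqSum_add_mul {b : ℕ} (hb : 2 ≤ b) {d : ℕ} (hd : d < b) (m : ℕ) :
    digitSqSum b (d + b * m) = d ^ 2 + digitSqSum b m := by
  have h := digitSqSum_add_pow_mul hb 1 (a := d) (by simpa using hd) m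
  rwa [pow_one, digitSqSum_of_lt hb hd] at h

theorem digitSqSum_pow_sub_one {b : ℕ} (hb : 2 ≤ b) (r : ℕ) :
    digitSqSum b (b ^ r - 1) = r * (b - 1) ^ 2 := by
  induction r with
  | zero => simp
  | succ r ih =>
    have e : b ^ (r + 1) - 1 = (b - 1) + b * (b ^ r - 1) := by
      have h : 0 < b ^ r := by positivity
      have h' : b ≤ b * b ^ r := Nat.le_mul_of_pos_right b h
      rw [pow_succ', Nat.mul_sub, mul_one]
      omega
    rw [e, digitSqSum_add_mul hb (by omega), ih]
    ring

theorem exists_digitSqSum_eq {b : ℕ} (hb : 2 ≤ b) (n : ℕ) :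
    ∃ a, n ≤ a ∧ digitSqSum b a = n := by
  induction n with
  | zero => exact ⟨0, le_rfl, by simp⟩
  | succ n ih =>
    obtain ⟨a, hna, ha⟩ := ih
    refine ⟨1 + b * a, ?_, ?_⟩
    · nlinarith
    · rw [digitSqSum_add_mul hb (by omega), ha]
      ring

theorem digitSqSum_mod_two {b : ℕ} (hb : 2 ≤ b) (hbo : Odd b) (a : ℕ) :
    digitSqSum b a % 2 = a % 2 := by
  induction a using Nat.strong_induction_on with
  | _ a ih =>
    rcases Nat.eq_zero_or_pos a with rfl | ha
    · simp
    · have hq := ih (a / b) (Nat.div_lt_self ha hb)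
      have hb2 := Nat.odd_iff.1 hbo
      conv_rhs => rw [← Nat.mod_add_div a b]
      rw [digitSqSum_rec hb a, Nat.add_mod, hq, Nat.add_mod (a % b), Nat.mul_mod, hb2, Nat.pow_mod]
      rcases Nat.mod_two_eq_zero_or_one (a % b) with h | h <;> simp [h]

theorem digitSqSum_le {b : ℕ} (hb : 2 ≤ b) (a : ℕ) : digitSqSum b a ≤ (b - 1) * a := by
  induction a using Nat.strong_induction_on with
  | _ a ih =>
    rcases Nat.eq_zero_or_pos a with rfl | ha
    · simp
    · have hq := ih (a / b) (Nat.div_lt_self ha hb)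
      have hm : a % b ≤ b - 1 := by have := Nat.mod_lt a (show b > 0 by omega); omega
      have hsq : (a % b) ^ 2 ≤ (b - 1) * (a % b) := by rw [pow_two]; gcongr
      have hle : a / b ≤ b * (a / b) := Nat.le_mul_of_pos_left _ (by omega)
      calc digitSqSum b a ≤ (b - 1) * (a % b) + (b - 1) * (b * (a / b)) := by
            rw [digitSqSum_rec hb a]
            exact add_le_add hsq (hq.trans (by gcongr))
        _ = (b - 1) * a := by rw [← mul_add, Nat.mod_add_div]

/-- Some common translate of `T` consists of numbers attracted to `u`. -/
def Attractable (c b u : ℕ) (T : Finset ℕ) : Prop :=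
  ∃ n, ∀ t ∈ T, ∃ k, (S c b)^[k] (t + n) = u

theorem Attractable.of_image_S {c b u : ℕ} (hb : 2 ≤ b) (m : ℕ) {T : Finset ℕ}
    (h : Attractable c b u (T.image fun t => S c b (t + m))) : Attractable c b u T := by
  obtain ⟨n, hn⟩ := h
  obtain ⟨a, -, ha⟩ := exists_digitSqSum_eq hb n
  set r := T.sup id + m + 1
  refine ⟨m + b ^ r * a, fun t ht => ?_⟩
  obtain ⟨k, hk⟩ := hn _ (Finset.mem_image_of_mem _ ht)
  have ht' : t ≤ T.sup id := Finset.le_sup (f := id) ht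
  have hlt : t + m < b ^ r := lt_of_le_of_lt (by omega) (Nat.lt_pow_self (n := r) hb)
  refine ⟨k + 1, ?_⟩
  rw [Function.iterate_succ_apply, ← add_assoc, S_eq, digitSqSum_add_pow_mul hb r hlt, ha,
    ← add_assoc]
  exact hk

/-- Translating and applying `S` makes the difference of two numbers `0` or `1`
modulo `b - 1`, according to its parity. -/
theorem exists_S_eq_add_mul {c b x y : ℕ} (hb : 3 ≤ b) (hbo : Odd b) (hxy : x < y) :
    ∃ m v, S c b (x + m) = S c b (y + m) + (b - 1) * v + (y - x) % 2 := by
  have hb2 : 2 ≤ b := by omega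
  obtain ⟨h, rfl⟩ := hbo
  have hh : 0 < h := by omega
  set b := 2 * h + 1 with hbdef
  set e := (y - x) % 2 with he
  have hpar := digitSqSum_mod_two hb2 ⟨h, hbdef⟩ (y - x - 1)
  set s := digitSqSum b (y - x - 1) with hs
  obtain ⟨q, hq⟩ : ∃ q, s + 1 + e = 2 * q := ⟨(s + 1 + e) / 2, by omega⟩
  obtain ⟨j, A, hj, hA⟩ : ∃ j A, j < h ∧ q + j = h * A := by
    have hlt := Nat.mod_lt q hh
    have hdm := Nat.mod_add_div q h
    rcases Nat.eq_zero_or_pos (q % h) with h0 | h0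
    · exact ⟨0, q / h, hh, by omega⟩
    · exact ⟨h - q % h, q / h + 1, by omega, by rw [mul_add]; omega⟩
  set r := A + y with hr
  have hpow : r < b ^ r := Nat.lt_pow_self (by omega)
  have hx : x + (b ^ r - 1 - x + b ^ r * j) = (b ^ r - 1) + b ^ r * j := by omega
  have hy : y + (b ^ r - 1 - x + b ^ r * j) = (y - x - 1) + b ^ r * (j + 1) := by
    rw [mul_add]; omega
  refine ⟨b ^ r - 1 - x + b ^ r * j, r * (b - 1) - A, ?_⟩
  rw [hx, hy, S_eq, S_eq, digitSqSum_add_pow_mul hb2 r (by omega),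
    digitSqSum_add_pow_mul hb2 r (by omega), digitSqSum_pow_sub_one hb2, ← hs,
    digitSqSum_of_lt hb2 (show j < b by omega), digitSqSum_of_lt hb2 (show j + 1 < b by omega)]
  have hb1 : b - 1 = 2 * h := by omega
  have hAr : A ≤ r * (2 * h) := by nlinarith
  obtain ⟨v, hv⟩ := Nat.exists_eq_add_of_le hAr
  rw [hb1, hv, Nat.add_sub_cancel_left]
  have hrv : r * (2 * h) ^ 2 = 2 * h * A + 2 * h * v := by rw [← mul_add, ← hv]; ring
  nlinarith

theorem exists_S_add_eq_add {c b y v e : ℕ} (hb : 2 ≤ b) (he : e < 2) :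
    ∃ m, S c b (y + (b - 1) * v + e + m) = S c b (y + m) + e := by
  set r := y + b * v + e with hr
  have hpow : r < b ^ r := Nat.lt_pow_self (by omega)
  have hv : v ≤ b * v := Nat.le_mul_of_pos_left _ (by omega)
  refine ⟨b ^ r + v - y, ?_⟩
  have hx : y + (b - 1) * v + e + (b ^ r + v - y) = (e + b * v) + b ^ r * 1 := by
    have : (b - 1) * v + v = b * v := by rw [← Nat.succ_mul]; congr 1; omega
    omega
  have hy : y + (b ^ r + v - y) = v + b ^ r * 1 := by omega
  rw [hx, hy, S_eq, S_eq, digitSqSum_add_pow_mul hb r (by omega),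
    digitSqSum_add_pow_mul hb r (by omega), digitSqSum_add_mul hb (by omega)]
  have : e ^ 2 = e := by interval_cases e <;> rfl
  omega

theorem exists_S_S_eq_add {c b x y : ℕ} (hb : 3 ≤ b) (hbo : Odd b) (hxy : x < y) :
    ∃ m n, S c b (S c b (x + m) + n) = S c b (S c b (y + m) + n) + (y - x) % 2 := by
  obtain ⟨m, v, h⟩ := exists_S_eq_add_mul (c := c) hb hbo hxy
  obtain ⟨n, hn⟩ := exists_S_add_eq_add (c := c) (b := b) (y := S c b (y + m)) (v := v)
    (e := (y - x) % 2) (by omega) (by omega)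
  exact ⟨m, n, by rw [h, hn]⟩

theorem Attractable.mono {c b u : ℕ} {T T' : Finset ℕ} (h : T ⊆ T')
    (hT' : Attractable c b u T') : Attractable c b u T :=
  hT'.imp fun _ hn t ht => hn t (h ht)

theorem attractable_consecutive {c b u p : ℕ} (hb : 2 ≤ b) (hp : c < p)
    (h₀ : ∃ k, (S c b)^[k] p = u) (h₁ : ∃ k, (S c b)^[k] (p + 1) = u) (w : ℕ) :
    Attractable c b u {w + 1, w} := by
  obtain ⟨a, hpa, ha⟩ := exists_digitSqSum_eq hb (p - c)
  have hpow : w + 1 < b ^ (w + 1) := Nat.lt_pow_self (by omega)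
  have hle : b ^ (w + 1) ≤ b ^ (w + 1) * a := Nat.le_mul_of_pos_right _ (by omega)
  have hd (d : ℕ) (hd : d < 2) : S c b (d + b ^ (w + 1) * a) = p + d := by
    rw [S_eq, digitSqSum_add_pow_mul hb _ (by omega), digitSqSum_of_lt hb (by omega), ha]
    interval_cases d <;> omega
  obtain ⟨k₀, hk₀⟩ := h₀
  obtain ⟨k₁, hk₁⟩ := h₁
  refine ⟨b ^ (w + 1) * a - w, fun t ht => ?_⟩
  rcases Finset.mem_insert.1 ht with rfl | ht
  · refine ⟨k₁ + 1, ?_⟩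
    rw [Function.iterate_succ_apply,
      show w + 1 + (b ^ (w + 1) * a - w) = 1 + b ^ (w + 1) * a by omega, hd 1 (by omega), hk₁]
  · obtain rfl := Finset.mem_singleton.1 ht
    refine ⟨k₀ + 1, ?_⟩
    rw [Function.iterate_succ_apply,
      show t + (b ^ (t + 1) * a - t) = 0 + b ^ (t + 1) * a by omega, hd 0 (by omega)]
    exact hk₀

theorem attractable_pair {c b u : ℕ} (hb : 3 ≤ b) (hbo : Odd b)
    (H : ∀ w, Attractable c b u {w + 1, w}) {x y : ℕ} (hxy : x < y) (hpar : (y - x) % 2 = 1) :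
    Attractable c b u {x, y} := by
  obtain ⟨m, n, h⟩ := exists_S_S_eq_add (c := c) hb hbo hxy
  refine .of_image_S (by omega) m (.of_image_S (by omega) n ?_)
  simpa [Finset.image_insert, h, hpar] using H _

theorem attractable_of_consecutive {c b u : ℕ} (hb : 3 ≤ b) (hbo : Odd b)
    (H : ∀ w, Attractable c b u {w + 1, w}) (T : Finset ℕ) : Attractable c b u T := by
  induction hT : T.card using Nat.strong_induction_on generalizing T with
  | _ d ih =>
    subst hT
    by_cases hsame : ∃ x ∈ T, ∃ y ∈ T, x < y ∧ (y - x) % 2 = 0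
    · obtain ⟨x, hx, y, hy, hxy, hpar⟩ := hsame
      obtain ⟨m, n, h⟩ := exists_S_S_eq_add (c := c) hb hbo hxy
      refine .of_image_S (by omega) m (.of_image_S (by omega) n (ih _ ?_ _ rfl))
      rw [Finset.image_image]
      refine lt_of_le_of_ne Finset.card_image_le fun hcard => ?_
      have := Finset.card_image_iff.1 hcard hx hy (by simpa [hpar] using h)
      omega
    · push Not at hsame
      have hsub (i : ℕ) (hi : i < 2) : ∃ x, x % 2 = i ∧ ∀ t ∈ T, t % 2 = i → t = x := by
        by_cases hx : ∃ x ∈ T, x % 2 = i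
        · obtain ⟨x, hxT, hx⟩ := hx
          refine ⟨x, hx, fun t ht hti => ?_⟩
          rcases lt_trichotomy t x with hlt | heq | hlt
          · have := hsame t ht x hxT hlt
            omega
          · exact heq
          · have := hsame x hxT t ht hlt
            omega
        · exact ⟨i, by omega, fun t ht hti => absurd ⟨t, ht, hti⟩ hx⟩
      obtain ⟨x, hx, hxT⟩ := hsub 0 (by omega)
      obtain ⟨y, hy, hyT⟩ := hsub 1 (by omega)
      have hT : T ⊆ {x, y} := fun t ht => by
        rcases Nat.mod_two_eq_zero_or_one t with h | h
        · simp [hxT t ht h]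
        · simp [hyT t ht h]
      rcases lt_or_gt_of_ne (show x ≠ y by rintro rfl; omega) with hlt | hlt
      · exact (attractable_pair hb hbo H hlt (by omega)).mono hT
      · rw [Finset.pair_comm] at hT
        exact (attractable_pair hb hbo H hlt (by omega)).mono hT

theorem S_lt_self {c b a : ℕ} (hc : c ≤ 9) (hb : 3 ≤ b) (hb9 : b ≤ 9) (ha : 256 ≤ a) :
    S c b a < a := by
  have hb2 : 2 ≤ b := by omega
  have hd (i : ℕ) : (i % b) ^ 2 ≤ (b - 1) ^ 2 := by
    have := Nat.mod_lt i (show b > 0 by omega)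
    gcongr
    omega
  have h₀ := hd a
  have h₁ := hd (a / b)
  have h₂ := hd (a / b / b)
  have h₃ := digitSqSum_le hb2 (a / b / b / b)
  rw [S_eq, digitSqSum_rec hb2 a, digitSqSum_rec hb2 (a / b), digitSqSum_rec hb2 (a / b / b)]
  generalize digitSqSum b (a / b / b / b) = s at *
  generalize (a % b) ^ 2 = s₀ at *
  generalize (a / b % b) ^ 2 = s₁ at *
  generalize (a / b / b % b) ^ 2 = s₂ at *
  interval_cases b <;> norm_num at h₀ h₁ h₂ h₃ <;> omega

/-- A version of `digitSqSum` that the kernel evaluates efficiently. -/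
def digitSqSumFuel (b : ℕ) : ℕ → ℕ → ℕ
  | 0, a => digitSqSum b a
  | n + 1, a => if a = 0 then 0 else (a % b) ^ 2 + digitSqSumFuel b n (a / b)

theorem digitSqSumFuel_eq {b : ℕ} (hb : 2 ≤ b) (n a : ℕ) :
    digitSqSumFuel b n a = digitSqSum b a := by
  induction n generalizing a with
  | zero => rfl
  | succ n ih =>
    rw [digitSqSumFuel]
    split_ifs with h
    · simp [h]
    · rw [ih, ← digitSqSum_rec hb]

/-- Whether one of the first `n` points of the orbit of `x` under `f` satisfies `P`. -/
def orbitMeets (f : ℕ → ℕ) (P : ℕ → Bool) : ℕ → ℕ → Bool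
  | 0, _ => false
  | n + 1, x => P x || orbitMeets f P n (f x)

theorem exists_iterate_of_orbitMeets {f : ℕ → ℕ} {P : ℕ → Bool} {n x : ℕ}
    (h : orbitMeets f P n x = true) : ∃ k, P (f^[k] x) = true := by
  induction n generalizing x with
  | zero => simp [orbitMeets] at h
  | succ n ih =>
    rw [orbitMeets, Bool.or_eq_true] at h
    rcases h with h | h
    · exact ⟨0, h⟩
    · obtain ⟨k, hk⟩ := ih h
      exact ⟨k + 1, hk⟩

/-- Checks that every positive `x < 256` has a point below `x` or a first component of `L` in its
orbit, and that for `(w, p) ∈ L` the consecutive numbers `p` and `p + 1` are attracted to `w`. -/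
def checkCycles (f : ℕ → ℕ) (c : ℕ) (L : List (ℕ × ℕ)) : Bool :=
  (List.range 256).all (fun x => x == 0 ||
    orbitMeets f (fun y => (y != 0 && decide (y < x)) || (L.map Prod.fst).contains y) 20 x) &&
  L.all fun q => decide (c < q.2) && orbitMeets f (· == q.1) 40 q.2 &&
    orbitMeets f (· == q.1) 40 (q.2 + 1)

theorem exists_iterate_mem_of_checkCycles {f : ℕ → ℕ} {c : ℕ} {L : List (ℕ × ℕ)}
    (h : checkCycles f c L = true) (hf : ∀ a, 256 ≤ a → f a < a) (hpos : ∀ a, 0 < f a)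
    {x : ℕ} (hx : 0 < x) : ∃ k, ∃ q ∈ L, f^[k] x = q.1 := by
  induction x using Nat.strong_induction_on with
  | _ x ih =>
    have descend (k : ℕ) (h0 : 0 < f^[k] x) (hlt : f^[k] x < x) :
        ∃ k, ∃ q ∈ L, f^[k] x = q.1 := by
      obtain ⟨j, q, hq, hj⟩ := ih _ hlt h0
      exact ⟨j + k, q, hq, by rw [Function.iterate_add_apply, hj]⟩
    rcases lt_or_ge x 256 with hlt | hge
    · rw [checkCycles, Bool.and_eq_true, List.all_eq_true] at h
      have hx' := h.1 x (List.mem_range.2 hlt)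
      rw [Bool.or_eq_true] at hx'
      rcases hx' with h0 | hx'
      · simp only [beq_iff_eq] at h0
        omega
      · obtain ⟨k, hk⟩ := exists_iterate_of_orbitMeets hx'
        simp only [Bool.or_eq_true, Bool.and_eq_true, bne_iff_ne, decide_eq_true_eq,
          List.contains_iff_mem, List.mem_map] at hk
        rcases hk with ⟨h0, hk⟩ | ⟨q, hq, hk⟩
        · exact descend k (Nat.pos_of_ne_zero h0) hk
        · exact ⟨k, q, hq, hk.symm⟩
    · exact descend 1 (hpos x) (hf x hge)

theorem exists_iterate_eq_of_iterate_eq_self {f : ℕ → ℕ} {u w m k : ℕ} (hm : 0 < m)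
    (hu : f^[m] u = u) (hk : f^[k] u = w) : ∃ j, f^[j] w = u := by
  refine ⟨m * k - k, ?_⟩
  rw [← hk, ← Function.iterate_add_apply, Nat.sub_add_cancel (Nat.le_mul_of_pos_left k hm)]
  exact (Function.IsPeriodicPt.mul_const hu k)

theorem exists_checkCycles {c b : ℕ} (hc : Odd c) (hbo : Odd b) (hc9 : c ≤ 9)
    (hb : 3 ≤ b) (hb9 : b ≤ 9) :
    ∃ L, checkCycles (fun a => c + digitSqSumFuel b 8 a) c L = true := by
  obtain ⟨i, rfl⟩ := hc
  obtain ⟨j, rfl⟩ := hbo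
  obtain ⟨hi, hj, hj'⟩ : i ≤ 4 ∧ 1 ≤ j ∧ j ≤ 4 := by omega
  interval_cases j <;> interval_cases i
  · exact ⟨[(5, 2)], by decide +kernel⟩
  · exact ⟨[(8, 4)], by decide +kernel⟩
  · exact ⟨[(6, 53), (7, 10), (8, 1115)], by decide +kernel⟩
  · exact ⟨[(8, 8)], by decide +kernel⟩
  · exact ⟨[(14, 10)], by decide +kernel⟩
  · exact ⟨[(2, 2)], by decide +kernel⟩
  · exact ⟨[(13, 4)], by decide +kernel⟩
  · exact ⟨[(6, 6)], by decide +kernel⟩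
  · exact ⟨[(13, 8)], by decide +kernel⟩
  · exact ⟨[(11, 10)], by decide +kernel⟩
  · exact ⟨[(10, 8), (26, 4)], by decide +kernel⟩
  · exact ⟨[(19, 4), (20, 10)], by decide +kernel⟩
  · exact ⟨[(6, 6), (10, 9), (25, 17)], by decide +kernel⟩
  · exact ⟨[(20, 8)], by decide +kernel⟩
  · exact ⟨[(34, 10)], by decide +kernel⟩
  · exact ⟨[(3, 2)], by decide +kernel⟩
  · exact ⟨[(4, 4)], by decide +kernel⟩
  · exact ⟨[(23, 6), (26, 73), (42, 12), (80, 66878)], by decide +kernel⟩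
  · exact ⟨[(8, 8), (23, 23), (41, 31), (44, 20)], by decide +kernel⟩
  · exact ⟨[(11, 10), (22, 21)], by decide +kernel⟩

theorem exists_consecutive_attracted {c b u : ℕ} (hc : Odd c) (hbo : Odd b) (hc9 : c ≤ 9)
    (hb : 3 ≤ b) (hb9 : b ≤ 9) (hu : inU c b u) :
    ∃ p, c < p ∧ (∃ k, (S c b)^[k] p = u) ∧ ∃ k, (S c b)^[k] (p + 1) = u := by
  obtain ⟨L, hL⟩ := exists_checkCycles hc hbo hc9 hb hb9
  have hS : (fun a => c + digitSqSumFuel b 8 a) = S c b := by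
    funext a
    rw [digitSqSumFuel_eq (by omega), S_eq]
  rw [hS] at hL
  obtain ⟨hu0, m, hm, hmu⟩ := hu
  obtain ⟨k, ⟨w, p⟩, hq, hk⟩ := exists_iterate_mem_of_checkCycles hL
    (fun a => S_lt_self hc9 hb hb9) (fun a => by have := hc.pos; rw [S_eq]; omega) hu0
  obtain ⟨j, hj⟩ := exists_iterate_eq_of_iterate_eq_self hm hmu hk
  rw [checkCycles, Bool.and_eq_true, List.all_eq_true, List.all_eq_true] at hL
  have hp := hL.2 _ hq
  simp only [Bool.and_eq_true, decide_eq_true_eq] at hp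
  have reach {x : ℕ} (hx : orbitMeets (S c b) (· == w) 40 x = true) :
      ∃ k, (S c b)^[k] x = u := by
    obtain ⟨i, hi⟩ := exists_iterate_of_orbitMeets hx
    rw [beq_iff_eq] at hi
    exact ⟨j + i, by rw [Function.iterate_add_apply, hi, hj]⟩
  exact ⟨p, hp.1.1, reach hp.1.2, reach hp.2⟩

theorem stmt_17 (c b : ℕ) (hc : Odd c) (hbo : Odd b)
    (hc9 : 1 ≤ c ∧ c ≤ 9) (hb9 : 3 ≤ b ∧ b ≤ 9)
    (u : ℕ) (hu : inU c b u) :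
    ∀ N : ℕ, 0 < N → ∃ n : ℕ, 0 < n ∧
      ∀ i : ℕ, i < N → ∃ k : ℕ, (S c b)^[k] (n + i) = u := by
  intro N _
  have hb2 : 2 ≤ b := by omega
  obtain ⟨p, hp, h₀, h₁⟩ := exists_consecutive_attracted hc hbo hc9.2 hb9.1 hb9.2 hu
  obtain ⟨n, hn⟩ := attractable_of_consecutive hb9.1 hbo
    (attractable_consecutive hb2 hp h₀ h₁) (Finset.Icc 1 N)
  refine ⟨n + 1, n.succ_pos, fun i hi => ?_⟩
  rw [show n + 1 + i = i + 1 + n by ring]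
  exact hn (i + 1) (Finset.mem_Icc.2 ⟨by omega, by omega⟩)
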